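/- Let T be a rooted tree and k a positive integer with k ≤ |V(T)|. Then there exists a set S ⊆ V(T) of size exactly k that is closed under taking descendants and satisfies H_k(T) = H_S(T). -/

import Mathlib

/-- A rooted tree on a node set `α`, given by its root and parent function
(the root is its own parent, and every node reaches the root by iterating `parent`). -/
structure RTree (α : Type*) where
  root : α
  parent : α → α
  parent_root : parent root = root
  reaches_root : ∀ v, ∃ k, parent^[k] v = root

namespace RTree

variable {α : Type*}

/-- `u` is a (weak) ancestor of `v` in `T`. -/
def ancestor (T : RTree α) (u v : α) : Prop := ∃ k, T.parent^[k] v = u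

/-- `u` is a proper ancestor of `v` in `T`. -/
def properAncestor (T : RTree α) (u v : α) : Prop := T.ancestor u v ∧ u ≠ v

/-- The node set of the subtree `T_v` of `T` rooted at `v`,
i.e. `v` together with all of its descendants. -/
def subtree (T : RTree α) (v : α) : Set α := {u | T.ancestor v u}

/-- A leaf of `T` is a node with no children. -/
def IsLeaf (T : RTree α) (v : α) : Prop := ∀ u, T.parent u = v → u = v

end RTree

/-- For `S ⊆ V(T)`, `H_S(T) = Σ_{v ∈ S} log₂(|S| / |V(T_v) ∩ S|)`. -/
noncomputable def entS {α : Type*} (T : RTree α) (S : Finset α) : ℝ :=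
  ∑ v ∈ S, Real.logb 2 ((S.card : ℝ) / ((T.subtree v ∩ ↑S).ncard : ℝ))

/-- For a positive integer `k`, `H_k(T) = max{ H_S(T) : S ⊆ V(T), |S| ≤ k }`. -/
noncomputable def entK {α : Type*} [Fintype α] (T : RTree α) (k : ℕ) : ℝ :=
  (Finset.filter (fun S => S.card ≤ k) (Finset.univ : Finset α).powerset).sup'
    ⟨∅, by simp⟩ (entS T)

/-- `S` is closed under taking descendants in `T`. -/
def DescClosed {α : Type*} (T : RTree α) (S : Finset α) : Prop :=
  ∀ v ∈ S, ∀ u ∈ T.subtree v, u ∈ S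

namespace RTree

variable {α : Type*} (T : RTree α)

theorem parent_iterate_root (n : ℕ) : T.parent^[n] T.root = T.root :=
  Function.iterate_fixed T.parent_root n

theorem ancestor_refl (v : α) : T.ancestor v v := ⟨0, rfl⟩

theorem ancestor_parent (v : α) : T.ancestor (T.parent v) v := ⟨1, rfl⟩

variable {T}

theorem ancestor_trans {u v w : α} (huv : T.ancestor u v) (hvw : T.ancestor v w) :
    T.ancestor u w := by
  obtain ⟨i, rfl⟩ := huv
  obtain ⟨j, rfl⟩ := hvw
  exact ⟨i + j, Function.iterate_add_apply _ _ _ _⟩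

theorem ancestor_antisymm {u v : α} (huv : T.ancestor u v) (hvu : T.ancestor v u) : u = v := by
  obtain ⟨i, hi⟩ := huv
  obtain ⟨j, hj⟩ := hvu
  rcases Nat.eq_zero_or_pos i with rfl | hpos
  · exact hi.symm
  · have hper : T.parent^[j + i] v = v := by rw [Function.iterate_add_apply, hi, hj]
    obtain ⟨m, hm⟩ := T.reaches_root v
    have hroot : v = T.root := by
      have h : T.parent^[(j + i) * m] v = v := by
        rw [Function.iterate_mul]
        exact Function.iterate_fixed hper m
      have hle : m ≤ (j + i) * m := Nat.le_mul_of_pos_left m (by omega)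
      rw [← Nat.sub_add_cancel hle, Function.iterate_add_apply, hm, parent_iterate_root] at h
      exact h.symm
    rw [hroot, parent_iterate_root] at hi
    rw [← hi, hroot]

theorem ancestor_total {u v w : α} (hu : T.ancestor u w) (hv : T.ancestor v w) :
    T.ancestor u v ∨ T.ancestor v u := by
  obtain ⟨i, rfl⟩ := hu
  obtain ⟨j, rfl⟩ := hv
  rcases le_total i j with h | h
  · exact Or.inr ⟨j - i, by rw [← Function.iterate_add_apply, Nat.sub_add_cancel h]⟩
  · exact Or.inl ⟨i - j, by rw [← Function.iterate_add_apply, Nat.sub_add_cancel h]⟩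

theorem ancestor_iff_ancestor_parent {u v : α} (h : u ≠ v) :
    T.ancestor u v ↔ T.ancestor u (T.parent v) := by
  refine ⟨?_, fun hu => ancestor_trans hu (T.ancestor_parent v)⟩
  rintro ⟨_ | i, hi⟩
  · exact absurd hi.symm h
  · exact ⟨i, by rwa [Function.iterate_succ_apply] at hi⟩

open Classical in
/-- The distance of a node from the root. -/
noncomputable def depth (T : RTree α) (v : α) : ℕ := Nat.find (T.reaches_root v)

theorem depth_parent_lt {v : α} (h : T.parent v ≠ v) : T.depth (T.parent v) < T.depth v := by
  classical
  have hspec := Nat.find_spec (T.reaches_root v)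
  have hd : T.depth v ≠ 0 := by
    intro h0
    have hv : v = T.root := by
      change T.parent^[T.depth v] v = T.root at hspec
      rwa [h0] at hspec
    exact h (by rw [hv, T.parent_root])
  obtain ⟨d, hd⟩ := Nat.exists_eq_succ_of_ne_zero hd
  change T.parent^[T.depth v] v = T.root at hspec
  rw [hd, Function.iterate_succ_apply] at hspec
  have : T.depth (T.parent v) ≤ d := Nat.find_min' _ hspec
  omega

open Classical in
/-- The number of nodes of `S` in the subtree of `T` rooted at `v`. -/
noncomputable def count (T : RTree α) (S : Finset α) (v : α) : ℕ :=
  (S.filter (T.ancestor v)).card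

theorem ncard_subtree_inter (S : Finset α) (v : α) :
    (T.subtree v ∩ ↑S).ncard = T.count S v := by
  classical
  rw [count, ← Set.ncard_coe_finset]
  congr 1
  ext u
  simp [subtree, and_comm]

theorem count_le_card (S : Finset α) (v : α) : T.count S v ≤ S.card := by
  classical
  exact Finset.card_filter_le _ _

theorem count_pos {S : Finset α} {v : α} (hv : v ∈ S) : 0 < T.count S v := by
  classical
  exact Finset.card_pos.mpr ⟨v, Finset.mem_filter.mpr ⟨hv, T.ancestor_refl v⟩⟩

theorem count_lt_count {S : Finset α} {u v : α} (hv : v ∈ S) (h : T.properAncestor v u) :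
    T.count S u < T.count S v := by
  classical
  refine Finset.card_lt_card (Finset.ssubset_iff_of_subset ?_ |>.mpr
    ⟨v, Finset.mem_filter.mpr ⟨hv, T.ancestor_refl v⟩, fun hvu => h.2 ?_⟩)
  · exact fun w hw => Finset.mem_filter.mpr ⟨(Finset.mem_filter.mp hw).1,
      ancestor_trans h.1 (Finset.mem_filter.mp hw).2⟩
  · exact ancestor_antisymm h.1 (Finset.mem_filter.mp hvu).2

theorem count_injOn_ancestors (S : Finset α) (u : α) :
    Set.InjOn (T.count S) {v | v ∈ S ∧ T.ancestor v u} := by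
  rintro v ⟨hvS, hv⟩ w ⟨hwS, hw⟩ hvw
  by_contra hne
  rcases ancestor_total hv hw with h | h
  · exact (count_lt_count hvS ⟨h, hne⟩).ne' hvw
  · exact (count_lt_count hwS ⟨h, Ne.symm hne⟩).ne hvw

theorem count_insert_of_ancestor [DecidableEq α] {S : Finset α} {u v : α} (hu : u ∉ S)
    (h : T.ancestor v u) : T.count (insert u S) v = T.count S v + 1 := by
  rw [count, count, Finset.filter_insert, if_pos h, Finset.card_insert_of_notMem (by simp [hu])]

theorem count_insert_of_not_ancestor [DecidableEq α] (S : Finset α) {u v : α}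
    (h : ¬ T.ancestor v u) : T.count (insert u S) v = T.count S v := by
  rw [count, count, Finset.filter_insert, if_neg h]

end RTree

section

open RTree

variable {α : Type*} {T : RTree α}

theorem entS_eq_sub (S : Finset α) :
    entS T S = S.card * Real.logb 2 S.card - ∑ v ∈ S, Real.logb 2 (T.count S v) := by
  rw [entS, ← nsmul_eq_mul, ← Finset.sum_const, ← Finset.sum_sub_distrib]
  refine Finset.sum_congr rfl fun v hv => ?_
  have hpos := count_pos (T := T) hv
  rw [ncard_subtree_inter, Real.logb_div]
  · exact_mod_cast (Finset.card_pos.mpr ⟨v, hv⟩).ne'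
  · exact_mod_cast hpos.ne'

theorem sum_logb_succ_sub_le {A : Finset ℕ} {c n : ℕ} (hcn : c ≤ n) (hA : A ⊆ Finset.Ioc c n) :
    ∑ a ∈ A, (Real.logb 2 ((a : ℝ) + 1) - Real.logb 2 a) ≤
      Real.logb 2 ((n : ℝ) + 1) - Real.logb 2 ((c : ℝ) + 1) := by
  have hterm : ∀ a : ℕ, 0 ≤ Real.logb 2 ((a : ℝ) + 1) - Real.logb 2 a := by
    intro a
    rcases Nat.eq_zero_or_pos a with rfl | ha
    · simp
    · have ha' : (0 : ℝ) < a := by exact_mod_cast ha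
      exact sub_nonneg.mpr (Real.logb_le_logb_of_le (by norm_num) ha' (by linarith))
  refine (Finset.sum_le_sum_of_subset_of_nonneg hA fun a _ _ => hterm a).trans_eq ?_
  clear hA
  induction n, hcn using Nat.le_induction with
  | base => simp
  | succ n hn ih =>
    rw [← Finset.insert_Ioc_right_eq_Ioc_add_one hn, Finset.sum_insert (by simp), ih]
    push_cast
    ring

theorem entS_le_entS_insert {S : Finset α} [DecidableEq α] {u : α} (hu : u ∉ S) :
    entS T S ≤ entS T (insert u S) := by
  classical
  have hself : T.count (insert u S) u = T.count S u + 1 :=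
    count_insert_of_ancestor hu (T.ancestor_refl u)
  have hsum : ∑ v ∈ S, Real.logb 2 (T.count (insert u S) v) - ∑ v ∈ S, Real.logb 2 (T.count S v) ≤
      Real.logb 2 ((S.card : ℝ) + 1) - Real.logb 2 ((T.count S u : ℝ) + 1) := by
    rw [← Finset.sum_sub_distrib]
    calc ∑ v ∈ S, (Real.logb 2 (T.count (insert u S) v) - Real.logb 2 (T.count S v))
        = ∑ v ∈ S with T.ancestor v u,
            (Real.logb 2 ((T.count S v : ℝ) + 1) - Real.logb 2 (T.count S v)) := by
          rw [Finset.sum_filter]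
          refine Finset.sum_congr rfl fun v _ => ?_
          split_ifs with h
          · rw [count_insert_of_ancestor hu h, Nat.cast_add_one]
          · rw [count_insert_of_not_ancestor S h, sub_self]
      _ = ∑ a ∈ {v ∈ S | T.ancestor v u}.image (T.count S),
            (Real.logb 2 ((a : ℝ) + 1) - Real.logb 2 a) := by
          rw [Finset.sum_image]
          exact fun v hv w hw => count_injOn_ancestors S u (by simpa using hv) (by simpa using hw)
      _ ≤ _ := by
          refine sum_logb_succ_sub_le (count_le_card S u) fun a ha => ?_
          obtain ⟨v, hv, rfl⟩ := Finset.mem_image.mp ha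
          obtain ⟨hvS, hvu⟩ := Finset.mem_filter.mp hv
          exact Finset.mem_Ioc.mpr
            ⟨count_lt_count hvS ⟨hvu, fun h => hu (h ▸ hvS)⟩, count_le_card S v⟩
  rw [entS_eq_sub, entS_eq_sub, Finset.sum_insert hu, Finset.card_insert_of_notMem hu, hself]
  push_cast
  have hlog : (S.card : ℝ) * Real.logb 2 S.card ≤ S.card * Real.logb 2 ((S.card : ℝ) + 1) := by
    rcases Nat.eq_zero_or_pos S.card with h | h
    · simp [h]
    · have h' : (0 : ℝ) < S.card := by exact_mod_cast h
      exact mul_le_mul_of_nonneg_left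
        (Real.logb_le_logb_of_le (by norm_num) h' (by linarith)) h'.le
  linarith

theorem entS_mono : Monotone (entS T) := by
  classical
  exact Finset.monotone_iff_forall_le_insert.mpr fun S u hu => entS_le_entS_insert hu

theorem entS_le_entS_insert_erase {S : Finset α} [DecidableEq α] {u : α} (hu : u ∉ S)
    (hp : T.parent u ∈ S) :
    entS T S ≤ entS T (insert u (S.erase (T.parent u))) := by
  classical
  set v := T.parent u
  set R := S.erase v
  have huR : u ∉ R := fun h => hu (Finset.mem_of_mem_erase h)
  have hvR : v ∉ R := Finset.notMem_erase v S
  have hS : S = insert v R := (Finset.insert_erase hp).symm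
  have huv : ∀ w ∈ R, T.count (insert u R) w = T.count (insert v R) w := by
    intro w hw
    have hiff := ancestor_iff_ancestor_parent (T := T) (show w ≠ u from fun h => huR (h ▸ hw))
    by_cases h : T.ancestor w u
    · rw [count_insert_of_ancestor huR h, count_insert_of_ancestor hvR (hiff.mp h)]
    · rw [count_insert_of_not_ancestor R h, count_insert_of_not_ancestor R (mt hiff.mpr h)]
  have hle : T.count (insert u R) u ≤ T.count (insert v R) v := by
    rw [count_insert_of_ancestor huR (T.ancestor_refl u),
      count_insert_of_ancestor hvR (T.ancestor_refl v)]
    exact Nat.add_le_add_right (Finset.card_le_card fun w hw =>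
      Finset.mem_filter.mpr ⟨(Finset.mem_filter.mp hw).1,
        ancestor_trans (T.ancestor_parent u) (Finset.mem_filter.mp hw).2⟩) 1
  rw [hS, entS_eq_sub, entS_eq_sub, Finset.sum_insert hvR, Finset.sum_insert huR,
    Finset.card_insert_of_notMem huR, Finset.card_insert_of_notMem hvR,
    Finset.sum_congr rfl fun w hw => congrArg (fun m : ℕ => Real.logb 2 m) (huv w hw)]
  have hpos := count_pos (T := T) (Finset.mem_insert_self u R)
  have hlog := Real.logb_le_logb_of_le (b := 2) (by norm_num)
    (show (0 : ℝ) < T.count (insert u R) u by exact_mod_cast hpos)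
    (show (T.count (insert u R) u : ℝ) ≤ T.count (insert v R) v by exact_mod_cast hle)
  linarith

theorem descClosed_of_forall_parent_mem {S : Finset α} (h : ∀ u, T.parent u ∈ S → u ∈ S) :
    DescClosed T S := by
  rintro v hv u ⟨i, hi⟩
  induction i generalizing u with
  | zero => exact (show u = v from hi) ▸ hv
  | succ i ih => exact h u (ih _ hi)

end

/-- For every rooted tree `T` and positive integer `k ≤ |V(T)|`, there is a set `S` of exactly
`k` nodes that is closed under taking descendants and attains `H_k(T)`. -/
theorem entK_attained_descClosed_card_eq {α : Type*} [Fintype α] (T : RTree α) (k : ℕ)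
    (hk : 0 < k) (hk' : k ≤ Fintype.card α) :
    ∃ S : Finset α, S.card = k ∧ DescClosed T S ∧ entK T k = entS T S := by
  classical
  have hle : ∀ S : Finset α, S.card = k → entS T S ≤ entK T k := fun S hS =>
    Finset.le_sup' (entS T) (by simp [hS])
  have hattained : ∃ S : Finset α, S.card = k ∧ entK T k = entS T S := by
    obtain ⟨S, hS, hSk⟩ := Finset.exists_mem_eq_sup'
      (s := Finset.filter (fun S => S.card ≤ k) (Finset.univ : Finset α).powerset)
      ⟨∅, by simp⟩ (entS T)
    obtain ⟨S', hSS', -, hcard⟩ := Finset.exists_subsuperset_card_eq (Finset.subset_univ S)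
      (Finset.mem_filter.mp hS).2 hk'
    exact ⟨S', hcard, le_antisymm (hSk.trans_le (entS_mono hSS')) (hle S' hcard)⟩
  obtain ⟨S, hS, hmax⟩ := Finset.exists_max_image
    {S : Finset α | S.card = k ∧ entK T k = entS T S} (fun S => ∑ v ∈ S, T.depth v)
    (hattained.imp fun S hS => by simpa using hS)
  simp only [Finset.mem_filter, Finset.mem_univ, true_and] at hS hmax
  refine ⟨S, hS.1, descClosed_of_forall_parent_mem fun u hp => ?_, hS.2⟩
  by_contra hu
  have huR : u ∉ S.erase (T.parent u) := fun h => hu (Finset.mem_of_mem_erase h)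
  have hcard : (insert u (S.erase (T.parent u))).card = k := by
    rw [Finset.card_insert_of_notMem huR, Finset.card_erase_add_one hp, hS.1]
  have hdepth := hmax _ ⟨hcard,
    le_antisymm (hS.2.trans_le (entS_le_entS_insert_erase hu hp)) (hle _ hcard)⟩
  rw [Finset.sum_insert huR, ← Finset.add_sum_erase S _ hp] at hdepth
  have := RTree.depth_parent_lt (T := T) (v := u) fun h => hu (h ▸ hp)
  omega
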